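/- arXiv:1309.1770 — 2 statements merged into one kernel-verified Lean document; each statement's English description precedes it below -/
import Mathlib

section
/- (Alexandrov) A convex function w : ℝⁿ → ℝ on an open convex set U is twice differentiable at almost every point of U: for a.e. x ∈ U there exist Dw(x) ∈ ℝⁿ and a symmetric matrix D²w(x) with w(y) = w(x) + ⟨Dw(x), y-x⟩ + ½⟨D²w(x)(y-x), y-x⟩ + o(|y-x|²). -/
open scoped RealInnerProductSpace Topology
open Filter MeasureTheory

/-- The quadratic form `⟨A v, v⟩` associated to a matrix `A`. -/
noncomputable def quad {n : ℕ} (A : Matrix (Fin n) (Fin n) ℝ)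
    (v : EuclideanSpace ℝ (Fin n)) : ℝ :=
  ∑ i, ∑ j, A i j * v i * v j

/-- `(p, A)` is an upper contact jet for `w` at `x₀`. -/
def UpperContactJet {n : ℕ} (w : EuclideanSpace ℝ (Fin n) → ℝ)
    (x₀ p : EuclideanSpace ℝ (Fin n)) (A : Matrix (Fin n) (Fin n) ℝ) : Prop :=
  ∀ᶠ y in 𝓝 x₀, w y ≤ w x₀ + ⟪p, y - x₀⟫ + (1 / 2) * quad A (y - x₀)

/-- `w` is twice differentiable at `x` with gradient `g` and Hessian `H`, in the sense of
a second-order Taylor expansion. -/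
def TwiceDiffAt {n : ℕ} (w : EuclideanSpace ℝ (Fin n) → ℝ)
    (x g : EuclideanSpace ℝ (Fin n)) (H : Matrix (Fin n) (Fin n) ℝ) : Prop :=
  HasGradientAt w g x ∧
    (fun y => w y - w x - ⟪g, y - x⟫ - (1 / 2) * quad H (y - x)) =o[𝓝 x]
      fun y => ‖y - x‖ ^ 2

/-- `w` is `lam`-quasi-convex on `U`: `w + (lam/2)|·|²` is convex on `U`. -/
def QCOn {n : ℕ} (lam : ℝ) (U : Set (EuclideanSpace ℝ (Fin n)))
    (w : EuclideanSpace ℝ (Fin n) → ℝ) : Prop :=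
  ConvexOn ℝ U (fun x => w x + (lam / 2) * ‖x‖ ^ 2)

section InnerProduct

variable {E : Type*} [NormedAddCommGroup E] [InnerProductSpace ℝ E]

/-- `y` is the proximal point of `z` for `w` on `K`, i.e. `z - y` is a subgradient at `y` of the
restriction of `w` to `K`. -/
def IsProx (w : E → ℝ) (K : Set E) (z y : E) : Prop :=
  y ∈ K ∧ ∀ v ∈ K, w y + ⟪z - y, v - y⟫ ≤ w v

theorem IsProx.norm_sub_sq_le {w : E → ℝ} {K : Set E} {z₁ z₂ y₁ y₂ : E}
    (h₁ : IsProx w K z₁ y₁) (h₂ : IsProx w K z₂ y₂) :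
    ‖y₁ - y₂‖ ^ 2 ≤ ⟪z₁ - z₂, y₁ - y₂⟫ := by
  have a := h₁.2 _ h₂.1
  have b := h₂.2 _ h₁.1
  rw [← real_inner_self_eq_norm_sq]
  simp only [inner_sub_left, inner_sub_right] at *
  rw [real_inner_comm y₂ y₁] at *
  linarith

theorem exists_isProx {w : E → ℝ} {K : Set E} (hK : IsCompact K) (hne : K.Nonempty)
    (hw : ConvexOn ℝ K w) (hc : ContinuousOn w K) (z : E) : ∃ y, IsProx w K z y := by
  obtain ⟨y, hy, hmin⟩ := hK.exists_isMinOn hne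
    (f := fun y => w y + ‖y - z‖ ^ 2 / 2) (by fun_prop)
  refine ⟨y, hy, fun v hv => ?_⟩
  have key : ∀ t ∈ Set.Ioo (0 : ℝ) 1,
      0 ≤ w v - w y + ⟪y - z, v - y⟫ + t * (‖v - y‖ ^ 2 / 2) := by
    intro t ht
    have hmem := hw.1 hy hv (sub_nonneg.2 ht.2.le) ht.1.le (by ring)
    have h1 := hmin hmem
    have h2 := hw.2 hy hv (sub_nonneg.2 ht.2.le) ht.1.le (by ring)
    have h3 : (1 - t) • y + t • v - z = (y - z) + t • (v - y) := by module
    simp only [Set.mem_ofPred_eq, h3, norm_add_sq_real, inner_smul_right, norm_smul,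
      smul_eq_mul, mul_pow, Real.norm_eq_abs, sq_abs] at h1 h2
    have : 0 ≤ t * (w v - w y + ⟪y - z, v - y⟫ + t * (‖v - y‖ ^ 2 / 2)) := by nlinarith
    exact nonneg_of_mul_nonneg_right this ht.1
  have hlim : Tendsto (fun t : ℝ => w v - w y + ⟪y - z, v - y⟫ + t * (‖v - y‖ ^ 2 / 2))
      (𝓝[>] 0) (𝓝 (w v - w y + ⟪y - z, v - y⟫ + 0 * (‖v - y‖ ^ 2 / 2))) :=
    (Continuous.tendsto (by fun_prop) 0).mono_left nhdsWithin_le_nhds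
  have := ge_of_tendsto hlim
    (by filter_upwards [Ioo_mem_nhdsGT (zero_lt_one (α := ℝ))] with t ht using key t ht)
  rw [← neg_sub y z, inner_neg_left]
  linarith

theorem ConvexOn.exists_subgradient [CompleteSpace E] {w : E → ℝ} {U : Set E} (hU : IsOpen U)
    (hw : ConvexOn ℝ U w) (hc : ContinuousOn w U) {x : E} (hx : x ∈ U) :
    ∃ p : E, ∀ v ∈ U, w x + ⟪p, v - x⟫ ≤ w v := by
  have hopen : IsOpen {q : E × ℝ | q.1 ∈ U ∧ w q.1 < q.2} := by
    have h1 : ContinuousOn (fun q : E × ℝ => q.2 - w q.1) (Prod.fst ⁻¹' U) :=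
      continuousOn_snd.sub (hc.comp continuousOn_fst fun q hq => hq)
    have := h1.isOpen_inter_preimage (hU.preimage continuous_fst) (isOpen_Ioi (a := (0 : ℝ)))
    convert this using 1
    ext q
    simp
  obtain ⟨f, hf⟩ := geometric_hahn_banach_open_point hw.convex_strict_epigraph hopen
    (x := (x, w x)) (by simp)
  have hsplit : ∀ (v : E) (t : ℝ), f (v, t) = f (v, 0) + t * f (0, 1) := by
    intro v t
    rw [← smul_eq_mul, ← map_smul, ← map_add]
    simp
  set c := f (0, 1)
  have hcneg : c < 0 := by
    have := hf (x, w x + 1) ⟨hx, by simp⟩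
    rw [hsplit x (w x + 1), hsplit x (w x)] at this
    linarith
  set g : StrongDual ℝ E := f.comp (ContinuousLinearMap.inl ℝ E ℝ)
  have hle : ∀ v ∈ U, g v + w v * c ≤ g x + w x * c := by
    intro v hv
    have hlim : Tendsto (fun t : ℝ => g v + t * c) (𝓝[>] (w v)) (𝓝 (g v + w v * c)) :=
      (Continuous.tendsto (by fun_prop) _).mono_left nhdsWithin_le_nhds
    refine le_of_tendsto hlim ?_
    filter_upwards [self_mem_nhdsWithin] with t ht
    have := hf (v, t) ⟨hv, ht⟩
    rw [hsplit v t, hsplit x (w x)] at this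
    exact this.le
  refine ⟨(InnerProductSpace.toDual ℝ E).symm ((-c)⁻¹ • g), fun v hv => ?_⟩
  rw [InnerProductSpace.toDual_symm_apply]
  have h := hle v hv
  simp only [smul_apply, map_sub, smul_eq_mul]
  have hc' : 0 < -c := by linarith
  have h2 : (-c)⁻¹ * (g v - g x) ≤ w v - w x := by
    rw [inv_mul_le_iff₀ hc']
    linarith
  linarith

/-- A firmly nonexpansive map with invertible derivative at `z` has a (multivalued) inverse that
is differentiable at the image of `z`. -/
theorem exists_norm_sub_symm_le_of_firmly_nonexpansive {P : E → E}
    (hP : ∀ a b, ‖P a - P b‖ ^ 2 ≤ ⟪a - b, P a - P b⟫) {T : E ≃L[ℝ] E} {z : E}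
    (hT : HasFDerivAt P (T : E →L[ℝ] E) z) {ε : ℝ} (hε : 0 < ε) :
    ∃ δ > 0, ∀ ζ, ‖P ζ - P z‖ < δ → ‖ζ - z - T.symm (P ζ - P z)‖ ≤ ε * ‖P ζ - P z‖ := by
  set S : E →L[ℝ] E := (T.symm : E →L[ℝ] E)
  set M : ℝ := ‖S‖ + 1
  have hMpos : 0 < M := by positivity
  set η : ℝ := min (1 / (2 * M)) (ε / (2 * M ^ 2))
  have hηpos : 0 < η := by positivity
  obtain ⟨r, hr, hball⟩ := Metric.eventually_nhds_iff_ball.1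
    (hT.isLittleO.def hηpos)
  have hSle : ∀ v, ‖T.symm v‖ ≤ M * ‖v‖ := fun v =>
    (S.le_opNorm v).trans (by gcongr; linarith)
  have hrem : ∀ ζ ∈ Metric.ball z r, ‖ζ - z - T.symm (P ζ - P z)‖ ≤ M * (η * ‖ζ - z‖) := by
    intro ζ hζ
    have h1 : ζ - z - T.symm (P ζ - P z) = -T.symm (P ζ - P z - T (ζ - z)) := by
      rw [map_sub T.symm _ (T (ζ - z)), T.symm_apply_apply]
      abel
    rw [h1, norm_neg]
    exact (hSle _).trans (by gcongr; exact hball ζ hζ)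
  have hlow : ∀ ζ ∈ Metric.ball z r, ‖ζ - z‖ ≤ 2 * M * ‖P ζ - P z‖ := by
    intro ζ hζ
    have h1 := hrem ζ hζ
    have h2 := hSle (P ζ - P z)
    have h3 := norm_le_norm_add_norm_sub' (ζ - z) (T.symm (P ζ - P z))
    have h4 : M * η ≤ 1 / 2 := by
      calc M * η ≤ M * (1 / (2 * M)) := by gcongr; exact min_le_left _ _
        _ = 1 / 2 := by field_simp
    nlinarith [norm_nonneg (ζ - z)]
  have hfar : ∀ ζ, ζ ∉ Metric.ball z r → r / (8 * M ^ 2) ≤ ‖P ζ - P z‖ := by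
    intro ζ hζ
    rw [mem_ball_iff_norm, not_lt] at hζ
    have hpos : 0 < ‖ζ - z‖ := hr.trans_le hζ
    set s : ℝ := r / (2 * ‖ζ - z‖) with hs
    have hs0 : 0 < s := by positivity
    have hsn : s * ‖ζ - z‖ = r / 2 := by rw [hs]; field_simp
    have hs1 : s < 1 := by
      rw [hs, div_lt_one (by positivity)]; linarith
    set ξ : E := z + s • (ζ - z) with hξ
    have e1 : ξ - z = s • (ζ - z) := by simp [hξ]
    have e2 : ζ - ξ = (1 - s) • (ζ - z) := by rw [hξ]; module
    have hn : ‖ξ - z‖ = r / 2 := by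
      rw [e1, norm_smul, Real.norm_of_nonneg hs0.le, hsn]
    have h1 := hlow ξ (by rw [mem_ball_iff_norm, hn]; linarith)
    have h2 := hP ξ z
    have h3 := hP ζ ξ
    rw [e1, real_inner_smul_left] at h2
    rw [e2, real_inner_smul_left] at h3
    have h4 : 0 ≤ ⟪ζ - z, P ζ - P ξ⟫ :=
      nonneg_of_mul_nonneg_right ((sq_nonneg _).trans h3) (by linarith)
    have h5 : ⟪ζ - z, P ζ - P z⟫ = ⟪ζ - z, P ζ - P ξ⟫ + ⟪ζ - z, P ξ - P z⟫ := by
      rw [← inner_add_right]; congr 1; abel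
    have h6 := real_inner_le_norm (ζ - z) (P ζ - P z)
    have h7 : ‖P ξ - P z‖ ^ 2 ≤ r / 2 * ‖P ζ - P z‖ := by
      calc ‖P ξ - P z‖ ^ 2 ≤ s * ⟪ζ - z, P ξ - P z⟫ := h2
        _ ≤ s * (‖ζ - z‖ * ‖P ζ - P z‖) := by gcongr; linarith
        _ = _ := by rw [← mul_assoc, hsn]
    rw [hn] at h1
    have h8 : (r / 2) ^ 2 ≤ (2 * M * ‖P ξ - P z‖) ^ 2 := by gcongr
    rw [div_le_iff₀ (by positivity)]
    have h9 : (r / 2) * (r / 2) ≤ (r / 2) * (4 * M ^ 2 * ‖P ζ - P z‖) := by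
      nlinarith [sq_nonneg M]
    have := le_of_mul_le_mul_left h9 (by positivity)
    linarith
  refine ⟨r / (8 * M ^ 2), by positivity, fun ζ hζ => ?_⟩
  have hmem : ζ ∈ Metric.ball z r := by
    by_contra h
    exact absurd (hfar ζ h) (not_le.2 hζ)
  calc ‖ζ - z - T.symm (P ζ - P z)‖ ≤ M * (η * ‖ζ - z‖) := hrem ζ hmem
    _ ≤ M * (ε / (2 * M ^ 2) * (2 * M * ‖P ζ - P z‖)) := by
        gcongr
        · exact min_le_right _ _
        · exact hlow ζ hmem
    _ = ε * ‖P ζ - P z‖ := by field_simp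

end InnerProduct

theorem le_of_forall_sub_le_mul_sq {ψ : ℝ → ℝ} {C : ℝ}
    (h : ∀ s t, 0 ≤ s → s ≤ t → t ≤ 1 → ψ t - ψ s ≤ C * (t - s) ^ 2) : ψ 1 ≤ ψ 0 := by
  have key : ∀ N : ℕ, ψ 1 - ψ 0 ≤ C * (1 / ((N : ℝ) + 1)) := by
    intro N
    have hN : (0 : ℝ) < (N : ℝ) + 1 := by positivity
    have hind : ∀ k : ℕ, k ≤ N + 1 →
        ψ (k / ((N : ℝ) + 1)) - ψ 0 ≤ k * (C * (1 / ((N : ℝ) + 1)) ^ 2) := by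
      intro k
      induction k with
      | zero => simp
      | succ k ih =>
        intro hk
        have hk' : (k : ℝ) + 1 ≤ (N : ℝ) + 1 := by exact_mod_cast hk
        have h1 := h (k / ((N : ℝ) + 1)) ((k + 1 : ℕ) / ((N : ℝ) + 1)) (by positivity)
          (by gcongr; simp) (by push_cast; rwa [div_le_one hN])
        have h2 := ih (by omega)
        have h3 : ((k + 1 : ℕ) : ℝ) / ((N : ℝ) + 1) - k / ((N : ℝ) + 1) = 1 / ((N : ℝ) + 1) := by
          push_cast; ring
        rw [h3] at h1
        push_cast at h1 ⊢
        linarith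
    have := hind (N + 1) le_rfl
    push_cast at this
    rw [div_self hN.ne'] at this
    calc ψ 1 - ψ 0 ≤ _ := this
      _ = _ := by field_simp
  have hlim := (tendsto_one_div_add_atTop_nhds_zero_nat (𝕜 := ℝ)).const_mul C
  rw [mul_zero] at hlim
  linarith [ge_of_tendsto' hlim key]

/-- Integration of a subgradient that is first-order expanded along a segment. -/
theorem abs_sub_sub_half_le_of_subgradient {φ g : ℝ → ℝ} {a b ε : ℝ}
    (hφ : ∀ s ∈ Set.Icc (0 : ℝ) 1, ∀ t ∈ Set.Icc (0 : ℝ) 1, φ s + g s * (t - s) ≤ φ t)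
    (hg : ∀ t ∈ Set.Icc (0 : ℝ) 1, |g t - a - b * t| ≤ ε * t) :
    |φ 1 - φ 0 - a - b / 2| ≤ ε / 2 := by
  have hup := le_of_forall_sub_le_mul_sq (ψ := fun t => φ t - a * t - (b + ε) * t ^ 2 / 2)
    (C := (b + ε) / 2) fun s t hs hst ht => by
      have h1 := hφ t ⟨hs.trans hst, ht⟩ s ⟨hs, hst.trans ht⟩
      have h2 := (abs_le.1 (hg t ⟨hs.trans hst, ht⟩)).2
      have h3 := mul_le_mul_of_nonneg_right h2 (sub_nonneg.2 hst)
      linarith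
  have hlo := le_of_forall_sub_le_mul_sq (ψ := fun t => -(φ t - a * t - (b - ε) * t ^ 2 / 2))
    (C := (b - ε) / 2) fun s t hs hst ht => by
      have h1 := hφ s ⟨hs, hst.trans ht⟩ t ⟨hs.trans hst, ht⟩
      have h2 := (abs_le.1 (hg s ⟨hs, hst.trans ht⟩)).1
      have h3 := mul_le_mul_of_nonneg_right h2 (sub_nonneg.2 hst)
      linarith
  rw [abs_le]
  constructor <;> linarith

theorem exists_quad_eq_inner {n : ℕ}
    (B : EuclideanSpace ℝ (Fin n) →L[ℝ] EuclideanSpace ℝ (Fin n)) :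
    ∃ H : Matrix (Fin n) (Fin n) ℝ, H.IsSymm ∧ ∀ v, quad H v = ⟪B v, v⟫ := by
  set e := EuclideanSpace.basisFun (Fin n) ℝ with he
  have hB : ∀ v, ⟪B v, v⟫ = ∑ i, ∑ j, ⟪B (e i), e j⟫ * v i * v j := by
    intro v
    have hv : v = ∑ i, v i • e i := by
      have := e.sum_repr v
      simpa [he] using this.symm
    conv_lhs => rw [hv]
    rw [map_sum, sum_inner]
    refine Finset.sum_congr rfl fun i _ => ?_
    rw [inner_sum]
    refine Finset.sum_congr rfl fun j _ => ?_
    rw [map_smul, real_inner_smul_left, real_inner_smul_right]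
    ring
  refine ⟨Matrix.of fun i j => (⟪B (e i), e j⟫ + ⟪B (e j), e i⟫) / 2, ?_, fun v => ?_⟩
  · ext i j
    simp only [Matrix.transpose_apply, Matrix.of_apply, add_comm]
  · have hsw : ∑ i, ∑ j, ⟪B (e i), e j⟫ * v i * v j = ∑ i, ∑ j, ⟪B (e j), e i⟫ * v i * v j := by
      rw [Finset.sum_comm]
      exact Finset.sum_congr rfl fun i _ => Finset.sum_congr rfl fun j _ => by ring
    have h2 : quad (Matrix.of fun i j => (⟪B (e i), e j⟫ + ⟪B (e j), e i⟫) / 2) v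
        = ((∑ i, ∑ j, ⟪B (e i), e j⟫ * v i * v j)
          + ∑ i, ∑ j, ⟪B (e j), e i⟫ * v i * v j) / 2 := by
      rw [quad, ← Finset.sum_add_distrib, Finset.sum_div]
      refine Finset.sum_congr rfl fun i _ => ?_
      rw [← Finset.sum_add_distrib, Finset.sum_div]
      exact Finset.sum_congr rfl fun j _ => by rw [Matrix.of_apply]; ring
    rw [h2, ← hsw, hB]
    ring

theorem twiceDiffAt_of_forall_eventually_le {n : ℕ} {w : EuclideanSpace ℝ (Fin n) → ℝ}
    {x g : EuclideanSpace ℝ (Fin n)} {H : Matrix (Fin n) (Fin n) ℝ}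
    {B : EuclideanSpace ℝ (Fin n) →L[ℝ] EuclideanSpace ℝ (Fin n)}
    (hH : ∀ v, quad H v = ⟪B v, v⟫)
    (h : ∀ ε > 0, ∀ᶠ y in 𝓝 x,
      |w y - w x - ⟪g, y - x⟫ - (1 / 2) * ⟪B (y - x), y - x⟫| ≤ ε * ‖y - x‖ ^ 2) :
    TwiceDiffAt w x g H := by
  have h2 : (fun y => w y - w x - ⟪g, y - x⟫ - (1 / 2) * quad H (y - x)) =o[𝓝 x]
      fun y => ‖y - x‖ ^ 2 := by
    refine Asymptotics.isLittleO_iff.2 fun ε hε => ?_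
    filter_upwards [h ε hε] with y hy
    simpa [hH, abs_of_nonneg (sq_nonneg ‖y - x‖)] using hy
  refine ⟨?_, h2⟩
  have hsq : (fun y => ‖y - x‖ ^ 2) =o[𝓝 x] fun y => y - x := by
    have h0 : Tendsto (fun y => y - x) (𝓝 x) (𝓝 0) := by
      simpa using (continuous_sub_right x).tendsto x
    exact (Asymptotics.isLittleO_norm_pow_id (E' := EuclideanSpace ℝ (Fin n))
      (n := 2) (by norm_num)).comp_tendsto h0
  have hq : (fun y => (1 / 2) * quad H (y - x)) =O[𝓝 x] fun y => ‖y - x‖ ^ 2 := by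
    refine Asymptotics.IsBigO.of_bound ‖B‖ (Eventually.of_forall fun y => ?_)
    have h1 := norm_inner_le_norm (𝕜 := ℝ) (B (y - x)) (y - x)
    have h3 := B.le_opNorm (y - x)
    have h4 := mul_le_mul_of_nonneg_right h3 (norm_nonneg (y - x))
    rw [hH, norm_mul, norm_pow, norm_norm, Real.norm_of_nonneg (by norm_num : (0 : ℝ) ≤ 1 / 2)]
    nlinarith [norm_nonneg (inner ℝ (B (y - x)) (y - x))]
  rw [hasGradientAt_iff_isLittleO]
  simpa using (h2.trans hsq).add (hq.trans_isLittleO hsq)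

theorem exists_twiceDiffAt_of_isProx {n : ℕ} {w : EuclideanSpace ℝ (Fin n) → ℝ}
    {K : Set (EuclideanSpace ℝ (Fin n))} {x : EuclideanSpace ℝ (Fin n)}
    {q P : EuclideanSpace ℝ (Fin n) → EuclideanSpace ℝ (Fin n)}
    (hx : x ∈ interior K) (hP : ∀ z, IsProx w K z (P z))
    (hq : ∀ y ∈ K, ∀ v ∈ K, w y + ⟪q y, v - y⟫ ≤ w v)
    (hgood : ∀ z, P z = x →
      ∃ T : EuclideanSpace ℝ (Fin n) ≃L[ℝ] EuclideanSpace ℝ (Fin n),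
        HasFDerivAt P (T : EuclideanSpace ℝ (Fin n) →L[ℝ] EuclideanSpace ℝ (Fin n)) z) :
    ∃ (g : EuclideanSpace ℝ (Fin n)) (H : Matrix (Fin n) (Fin n) ℝ),
      H.IsSymm ∧ TwiceDiffAt w x g H := by
  have hPq : ∀ y ∈ K, P (y + q y) = y := by
    intro y hy
    have h1 : IsProx w K (y + q y) y := ⟨hy, by simpa using hq y hy⟩
    have h2 := (hP (y + q y)).norm_sub_sq_le h1
    simp only [sub_self, inner_zero_left] at h2
    exact sub_eq_zero.1 (norm_eq_zero.1 (pow_eq_zero_iff two_ne_zero |>.1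
      (le_antisymm h2 (sq_nonneg _))))
  have hxK : x ∈ K := interior_subset hx
  obtain ⟨T, hT⟩ := hgood _ (hPq x hxK)
  set B : EuclideanSpace ℝ (Fin n) →L[ℝ] EuclideanSpace ℝ (Fin n) :=
    (T.symm : EuclideanSpace ℝ (Fin n) →L[ℝ] EuclideanSpace ℝ (Fin n)) -
      ContinuousLinearMap.id ℝ _ with hB
  obtain ⟨H, hsymm, hH⟩ := exists_quad_eq_inner B
  refine ⟨q x, H, hsymm, twiceDiffAt_of_forall_eventually_le hH fun ε hε => ?_⟩
  obtain ⟨δ, hδ, hδ'⟩ := exists_norm_sub_symm_le_of_firmly_nonexpansive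
    (fun a b => (hP a).norm_sub_sq_le (hP b)) hT hε
  obtain ⟨ρ, hρ, hρK⟩ := Metric.mem_nhds_iff.1 (mem_interior_iff_mem_nhds.1 hx)
  rw [Metric.eventually_nhds_iff_ball]
  refine ⟨min δ ρ, lt_min hδ hρ, fun y hy => ?_⟩
  set h := y - x with hh
  rw [mem_ball_iff_norm, ← hh] at hy
  have hnorm : ∀ t ∈ Set.Icc (0 : ℝ) 1, ‖t • h‖ < min δ ρ := by
    intro t ht
    rw [norm_smul, Real.norm_of_nonneg ht.1]
    exact (mul_le_of_le_one_left (norm_nonneg h) ht.2).trans_lt hy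
  have hK : ∀ t ∈ Set.Icc (0 : ℝ) 1, x + t • h ∈ K := by
    intro t ht
    apply hρK
    rw [mem_ball_iff_norm, add_sub_cancel_left]
    exact (hnorm t ht).trans_le (min_le_right _ _)
  have hmain := abs_sub_sub_half_le_of_subgradient (φ := fun t => w (x + t • h))
    (g := fun t => ⟪q (x + t • h), h⟫) (a := ⟪q x, h⟫) (b := ⟪B h, h⟫) (ε := ε * ‖h‖ ^ 2)
    (fun s hs t ht => by
      have h1 := hq _ (hK s hs) _ (hK t ht)
      have h2 : x + t • h - (x + s • h) = (t - s) • h := by module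
      rw [h2, real_inner_smul_right] at h1
      linarith)
    (fun t ht => by
      have h1 := hδ' (x + t • h + q (x + t • h))
      rw [hPq _ (hK t ht), hPq _ hxK, add_sub_cancel_left] at h1
      have h2 := h1 ((hnorm t ht).trans_le (min_le_left _ _))
      have h3 : x + t • h + q (x + t • h) - (x + q x) - T.symm (t • h)
          = q (x + t • h) - q x - t • B h := by
        simp only [hB, map_smul, sub_apply, ContinuousLinearMap.id_apply,
          ContinuousLinearEquiv.coe_coe]
        module
      rw [h3, norm_smul, Real.norm_of_nonneg ht.1] at h2
      have h4 : ⟪q (x + t • h), h⟫ - ⟪q x, h⟫ - ⟪B h, h⟫ * t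
          = ⟪q (x + t • h) - q x - t • B h, h⟫ := by
        rw [inner_sub_left, inner_sub_left, real_inner_smul_left]
        ring
      rw [h4]
      calc _ ≤ ‖q (x + t • h) - q x - t • B h‖ * ‖h‖ := abs_real_inner_le_norm _ _
        _ ≤ ε * (t * ‖h‖) * ‖h‖ := by gcongr
        _ = _ := by ring)
  simp only [one_smul, zero_smul, add_zero] at hmain
  have hxy : x + h = y := by rw [hh]; abel
  rw [hxy] at hmain
  have : 0 ≤ ε * ‖h‖ ^ 2 := by positivity
  rw [one_div, inv_mul_eq_div]
  linarith

section Null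

variable {E : Type*} [NormedAddCommGroup E] [NormedSpace ℝ E] [FiniteDimensional ℝ E]
  [MeasurableSpace E] [BorelSpace E] (μ : Measure E) [μ.IsAddHaarMeasure]

theorem LipschitzWith.addHaar_image_eq_zero {C : NNReal} {f : E → E} (hf : LipschitzWith C f)
    {s : Set E} (hs : μ s = 0) : μ (f '' s) = 0 := by
  have hac : μ ≪ μH[Module.finrank ℝ E] := Measure.absolutelyContinuous_isAddHaarMeasure _ _
  have hac' : μH[Module.finrank ℝ E] ≪ μ := Measure.absolutelyContinuous_isAddHaarMeasure _ _
  refine hac (le_antisymm ?_ zero_le)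
  calc _ ≤ _ := hf.hausdorffMeasure_image_le (Nat.cast_nonneg _) s
    _ = 0 := by rw [hac' hs, mul_zero]

/-- Almost every point is a value only at points where a Lipschitz map has invertible
derivative. -/
theorem LipschitzWith.ae_forall_preimage_exists_equiv {C : NNReal} {f : E → E}
    (hf : LipschitzWith C f) :
    ∀ᵐ x ∂μ, ∀ z, f z = x → ∃ T : E ≃L[ℝ] E, HasFDerivAt f (T : E →L[ℝ] E) z := by
  have h1 : μ (f '' {z | ¬ DifferentiableAt ℝ f z}) = 0 :=
    hf.addHaar_image_eq_zero μ hf.ae_differentiableAt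
  have h2 : μ (f '' {z | DifferentiableAt ℝ f z ∧ (fderiv ℝ f z).det = 0}) = 0 :=
    addHaar_image_eq_zero_of_det_fderivWithin_eq_zero μ
      (fun z hz => hz.1.hasFDerivAt.hasFDerivWithinAt) (fun z hz => hz.2)
  filter_upwards [measure_eq_zero_iff_ae_notMem.1 h1, measure_eq_zero_iff_ae_notMem.1 h2]
    with x hx1 hx2 z hz
  have hd : DifferentiableAt ℝ f z := by
    by_contra h
    exact hx1 ⟨z, h, hz⟩
  have hdet : (fderiv ℝ f z).det ≠ 0 := fun h => hx2 ⟨z, ⟨hd, h⟩, hz⟩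
  refine ⟨(fderiv ℝ f z).toContinuousLinearEquivOfDetNeZero hdet, ?_⟩
  rw [ContinuousLinearMap.coe_toContinuousLinearEquivOfDetNeZero]
  exact hd.hasFDerivAt

end Null

/-- (Alexandrov) A convex function on an open convex set `U ⊆ ℝⁿ` is twice differentiable
(in the sense of a second-order Taylor expansion with symmetric Hessian) at almost every
point of `U`. -/
theorem stmt_9 {n : ℕ} (U : Set (EuclideanSpace ℝ (Fin n)))
    (hU : IsOpen U) (hUc : Convex ℝ U)
    (w : EuclideanSpace ℝ (Fin n) → ℝ) (hw : ConvexOn ℝ U w) :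
    ∀ᵐ x ∂(volume.restrict U),
      ∃ (g : EuclideanSpace ℝ (Fin n)) (H : Matrix (Fin n) (Fin n) ℝ),
        H.IsSymm ∧ TwiceDiffAt w x g H := by
  have hc : ContinuousOn w U := hw.continuousOn hU
  have hsub : ∀ y, ∃ p, y ∈ U → ∀ v ∈ U, w y + ⟪p, v - y⟫ ≤ w v := by
    intro y
    by_cases hy : y ∈ U
    · obtain ⟨p, hp⟩ := hw.exists_subgradient hU hc hy
      exact ⟨p, fun _ => hp⟩
    · exact ⟨0, fun h => absurd h hy⟩
  choose q hq using hsub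
  rw [ae_restrict_iff' hU.measurableSet, ae_iff]
  refine measure_null_of_locally_null _ fun x₀ hx₀ => ?_
  have hx₀U : x₀ ∈ U := by
    by_contra h
    exact hx₀ fun h' => absurd h' h
  obtain ⟨r, hr, hrU⟩ := Metric.nhds_basis_closedBall.mem_iff.1 (hU.mem_nhds hx₀U)
  set K := Metric.closedBall x₀ r
  choose P hP using exists_isProx (isCompact_closedBall x₀ r)
    ⟨x₀, Metric.mem_closedBall_self hr.le⟩ (hw.subset hrU (convex_closedBall x₀ r)) (hc.mono hrU)
  have hlip : LipschitzWith 1 P := by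
    refine LipschitzWith.of_dist_le_mul fun a b => ?_
    rw [NNReal.coe_one, one_mul, dist_eq_norm, dist_eq_norm]
    have h1 := (hP a).norm_sub_sq_le (hP b)
    have h2 := real_inner_le_norm (a - b) (P a - P b)
    by_contra! h
    nlinarith [norm_nonneg (a - b)]
  have hbad := ae_iff.1 (hlip.ae_forall_preimage_exists_equiv volume)
  refine ⟨_, inter_mem_nhdsWithin _ (Metric.ball_mem_nhds x₀ hr),
    measure_mono_null (fun x hx => ?_) hbad⟩
  intro hgood
  refine hx.1 fun _ => exists_twiceDiffAt_of_isProx (K := K) (q := q) ?_ hP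
    (fun y hy v hv => hq y (hrU hy) v (hrU hv)) hgood
  exact Metric.ball_subset_interior_closedBall hx.2
end

section
/- (Jensen–Slodkowski) Let w be a λ-quasi-convex function on a neighborhood of x₀ in ℝⁿ possessing a strict upper contact jet (p₀, A₀) at x₀. Then there exists ρ̄ > 0 such that for every 0 < ρ ≤ ρ̄, the set C(w, B_ρ(x₀), A₀) of global upper contact points of type A₀ for w on the ball B_ρ(x₀) has positive Lebesgue measure. -/
open scoped RealInnerProductSpace Topology
open Filter MeasureTheory

/-- A set whose image under a Lipschitz self-map has nonempty interior has positive Haar measure. -/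
theorem LipschitzOnWith.measure_pos_of_interior_image_nonempty {E : Type*} [NormedAddCommGroup E]
    [NormedSpace ℝ E] [FiniteDimensional ℝ E] [MeasurableSpace E] [BorelSpace E]
    (μ : Measure E) [μ.IsAddHaarMeasure] {K : NNReal} {G : E → E} {s : Set E}
    (hG : LipschitzOnWith K G s) (hs : (interior (G '' s)).Nonempty) : 0 < μ s := by
  let ν : Measure E := Measure.hausdorffMeasure (Module.finrank ℝ E : ℝ)
  have hν : 0 < ν (G '' s) :=
    (isOpen_interior.measure_pos ν hs).trans_le (measure_mono interior_subset)
  rw [pos_iff_ne_zero]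
  intro h0
  have h1 : ν s = 0 := Measure.absolutelyContinuous_isAddHaarMeasure ν μ h0
  have h2 := hG.hausdorffMeasure_image_le (d := (Module.finrank ℝ E : ℝ)) (Nat.cast_nonneg _)
  change ν (G '' s) ≤ _ * ν s at h2
  rw [h1, mul_zero] at h2
  exact absurd h2 (not_le.2 hν)

section AffineContact

variable {E : Type*} [NormedAddCommGroup E] [InnerProductSpace ℝ E]

/-- Slopes of affine functions touching a semiconvex function from above depend on the contact
point in a Lipschitz way. -/
theorem norm_sub_slope_le {f : E → ℝ} {x₀ : E} {ρ C : ℝ}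
    (hf : ∀ x h, x + h ∈ Metric.ball x₀ ρ → x - h ∈ Metric.ball x₀ ρ →
      2 * f x ≤ f (x + h) + f (x - h) + C * ‖h‖ ^ 2) (hC : 0 ≤ C)
    {x₁ x₂ q₁ q₂ : E} (hx₁ : x₁ ∈ Metric.ball x₀ (ρ / 6)) (hx₂ : x₂ ∈ Metric.ball x₀ (ρ / 6))
    (hq₁ : ∀ y ∈ Metric.ball x₀ ρ, f y ≤ f x₁ + ⟪q₁, y - x₁⟫)
    (hq₂ : ∀ y ∈ Metric.ball x₀ ρ, f y ≤ f x₂ + ⟪q₂, y - x₂⟫) :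
    ‖q₁ - q₂‖ ≤ 4 * C * ‖x₁ - x₂‖ := by
  rw [mem_ball_iff_norm] at hx₁ hx₂
  have hd : ‖x₁ - x₂‖ < ρ / 3 := by
    have := norm_sub_le (x₁ - x₀) (x₂ - x₀)
    rw [sub_sub_sub_cancel_right] at this
    linarith
  have key : ∀ t, ‖x₁ - x₂‖ < t → t < ρ / 3 → ‖q₁ - q₂‖ ≤ 4 * C * t := by
    intro t ht htρ
    have ht0 : 0 < t := (norm_nonneg _).trans_lt ht
    rcases eq_or_ne q₁ q₂ with rfl | hne
    · simp only [sub_self, norm_zero]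
      positivity
    have hq : 0 < ‖q₁ - q₂‖ := norm_pos_iff.2 (sub_ne_zero.2 hne)
    set h : E := (t / ‖q₁ - q₂‖) • (q₁ - q₂) with hh
    have hnorm : ‖h‖ = t := by
      rw [hh, norm_smul, Real.norm_of_nonneg (by positivity)]
      field_simp
    have hinner : ⟪q₁, h⟫ - ⟪q₂, h⟫ = t * ‖q₁ - q₂‖ := by
      rw [← inner_sub_left, hh, real_inner_smul_right, real_inner_self_eq_norm_sq]
      field_simp
    set u : E := x₂ - x₁ + h with hu
    have hun : ‖u‖ ≤ 2 * t := by
      have := norm_add_le (x₂ - x₁) h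
      rw [norm_sub_rev x₂ x₁] at this
      linarith
    have hb₁ : x₁ + u ∈ Metric.ball x₀ ρ := by
      rw [mem_ball_iff_norm]
      have := norm_add_le (x₁ - x₀) u
      rw [show x₁ - x₀ + u = x₁ + u - x₀ by abel] at this
      linarith
    have hb₂ : x₁ - u ∈ Metric.ball x₀ ρ := by
      rw [mem_ball_iff_norm]
      have := norm_sub_le (x₁ - x₀) u
      rw [show x₁ - x₀ - u = x₁ - u - x₀ by abel] at this
      linarith
    have hb₃ : x₂ ∈ Metric.ball x₀ ρ := by
      rw [mem_ball_iff_norm]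
      have := norm_nonneg (x₂ - x₀)
      linarith
    have e1 := hf x₁ u hb₁ hb₂
    have e2 := hq₁ _ hb₂
    have e3 := hq₂ _ hb₁
    have e4 := hq₁ _ hb₃
    rw [show x₁ - u - x₁ = -u by abel, inner_neg_right] at e2
    rw [show x₁ + u - x₂ = h by rw [hu]; abel] at e3
    have e5 : ⟪q₁, u⟫ = ⟪q₁, x₂ - x₁⟫ + ⟪q₁, h⟫ := by rw [hu, inner_add_right]
    have e6 : C * ‖u‖ ^ 2 ≤ C * (2 * t) ^ 2 := by gcongr
    have e7 : t * ‖q₁ - q₂‖ ≤ t * (4 * C * t) := by linarith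
    exact le_of_mul_le_mul_left e7 ht0
  have hlim : Tendsto (fun t => 4 * C * t) (𝓝[>] ‖x₁ - x₂‖) (𝓝 (4 * C * ‖x₁ - x₂‖)) :=
    (Continuous.tendsto (by fun_prop) _).mono_left nhdsWithin_le_nhds
  refine ge_of_tendsto hlim ?_
  filter_upwards [Ioo_mem_nhdsGT hd] with t ht
  exact key t ht.1 ht.2

/-- If `f` is negative away from `x₀` and `f x₀ = 0`, then every small vector is the slope
of an affine function touching `f` from above near `x₀`. -/
theorem exists_slope_of_strict_max [FiniteDimensional ℝ E] {f : E → ℝ} {x₀ : E} {ρ : ℝ}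
    (hρ : 0 < ρ) (hcont : ContinuousOn f (Metric.closedBall x₀ ρ)) (h0 : f x₀ = 0)
    (hneg : ∀ y ∈ Metric.closedBall x₀ ρ, y ≠ x₀ → f y < 0) {ε : ℝ} (hε : 0 < ε) :
    ∃ δ > 0, ∀ q ∈ Metric.ball (0 : E) δ, ∃ x ∈ Metric.ball x₀ ε,
      ∀ y ∈ Metric.ball x₀ ρ, f y ≤ f x + ⟪q, y - x⟫ := by
  obtain ⟨m, hm, hfm⟩ : ∃ m < 0, ∀ y ∈ Metric.closedBall x₀ ρ \ Metric.ball x₀ ε, f y ≤ m := by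
    have hK : IsCompact (Metric.closedBall x₀ ρ \ Metric.ball x₀ ε) :=
      (isCompact_closedBall x₀ ρ).diff Metric.isOpen_ball
    rcases (Metric.closedBall x₀ ρ \ Metric.ball x₀ ε).eq_empty_or_nonempty with he | hne
    · exact ⟨-1, by norm_num, by simp [he]⟩
    · obtain ⟨z, hz, hmax⟩ := hK.exists_isMaxOn hne (hcont.mono Set.sdiff_subset)
      refine ⟨f z, hneg z hz.1 ?_, fun y hy => hmax hy⟩
      rintro rfl
      exact hz.2 (Metric.mem_ball_self hε)
  refine ⟨-m / ρ, div_pos (neg_pos.2 hm) hρ, fun q hq => ?_⟩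
  rw [mem_ball_zero_iff, lt_div_iff₀ hρ] at hq
  have hx₀ : x₀ ∈ Metric.closedBall x₀ ρ := Metric.mem_closedBall_self hρ.le
  obtain ⟨x, hx, hmax⟩ := (isCompact_closedBall x₀ ρ).exists_isMaxOn ⟨x₀, hx₀⟩
    (f := fun y => f y - ⟪q, y - x₀⟫) (hcont.sub (by fun_prop))
  refine ⟨x, ?_, fun y hy => ?_⟩
  · by_contra hxε
    have e1 := hfm x ⟨hx, hxε⟩
    have e2 : f x₀ - ⟪q, x₀ - x₀⟫ ≤ f x - ⟪q, x - x₀⟫ := hmax hx₀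
    rw [sub_self, inner_zero_right, h0] at e2
    have e3 := (abs_le.1 (abs_real_inner_le_norm q (x - x₀))).1
    have e4 : ‖q‖ * ‖x - x₀‖ ≤ ‖q‖ * ρ := by
      gcongr
      exact mem_closedBall_iff_norm.1 hx
    linarith
  · have e : f y - ⟪q, y - x₀⟫ ≤ f x - ⟪q, x - x₀⟫ := hmax (Metric.ball_subset_closedBall hy)
    have : ⟪q, y - x⟫ = ⟪q, y - x₀⟫ - ⟪q, x - x₀⟫ := by
      rw [← inner_sub_right, sub_sub_sub_cancel_right]
    linarith

/-- The points at which a semiconvex function with a strict local maximum is touched from above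
by affine functions form a set of positive measure. -/
theorem measure_affine_contact_pos [FiniteDimensional ℝ E] [MeasurableSpace E] [BorelSpace E]
    (μ : Measure E) [μ.IsAddHaarMeasure] {f : E → ℝ} {x₀ : E} {ρ C : ℝ}
    (hρ : 0 < ρ) (hcont : ContinuousOn f (Metric.closedBall x₀ ρ)) (h0 : f x₀ = 0)
    (hneg : ∀ y ∈ Metric.closedBall x₀ ρ, y ≠ x₀ → f y < 0)
    (hf : ∀ x h, x + h ∈ Metric.ball x₀ ρ → x - h ∈ Metric.ball x₀ ρ →
      2 * f x ≤ f (x + h) + f (x - h) + C * ‖h‖ ^ 2) (hC : 0 ≤ C) :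
    0 < μ {x | x ∈ Metric.ball x₀ ρ ∧ ∃ q : E,
      ∀ y ∈ Metric.ball x₀ ρ, f y ≤ f x + ⟪q, y - x⟫} := by
  obtain ⟨δ, hδ, H⟩ := exists_slope_of_strict_max hρ hcont h0 hneg
    (show 0 < ρ / 6 by positivity)
  set S : Set E := {x | x ∈ Metric.ball x₀ (ρ / 6) ∧ ∃ q : E,
      ∀ y ∈ Metric.ball x₀ ρ, f y ≤ f x + ⟪q, y - x⟫} with hS
  have hslope : ∀ x : E, ∃ q : E, x ∈ S → ∀ y ∈ Metric.ball x₀ ρ, f y ≤ f x + ⟪q, y - x⟫ := by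
    intro x
    by_cases hx : x ∈ S
    · exact hx.2.imp fun q hq _ => hq
    · exact ⟨0, fun h => absurd h hx⟩
  choose G hG using hslope
  have hlip : LipschitzOnWith (4 * C).toNNReal G S := by
    refine LipschitzOnWith.of_dist_le_mul fun x hx y hy => ?_
    rw [Real.coe_toNNReal _ (by positivity), dist_eq_norm, dist_eq_norm]
    exact norm_sub_slope_le hf hC hx.1 hy.1 (hG x hx) (hG y hy)
  have himage : Metric.ball (0 : E) δ ⊆ G '' S := by
    intro q hq
    obtain ⟨x, hx, hxq⟩ := H q hq
    have hxS : x ∈ S := ⟨hx, q, hxq⟩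
    refine ⟨x, hxS, ?_⟩
    have := norm_sub_slope_le hf hC hx hx (hG x hxS) hxq
    rw [sub_self, norm_zero, mul_zero] at this
    exact sub_eq_zero.1 (norm_le_zero_iff.1 this)
  have hpos : 0 < μ S := hlip.measure_pos_of_interior_image_nonempty μ
    ⟨0, interior_mono himage (by simpa [Metric.isOpen_ball.interior_eq] using hδ)⟩
  exact hpos.trans_le <| measure_mono fun x hx =>
    ⟨Metric.ball_subset_ball (by linarith) hx.1, hx.2⟩

end AffineContact

theorem quad_smul {n : ℕ} (A : Matrix (Fin n) (Fin n) ℝ) (c : ℝ)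
    (v : EuclideanSpace ℝ (Fin n)) : quad A (c • v) = c ^ 2 * quad A v := by
  simp only [quad, Finset.mul_sum, PiLp.smul_apply, smul_eq_mul]
  refine Finset.sum_congr rfl fun i _ => Finset.sum_congr rfl fun j _ => ?_
  ring

theorem exists_quad_add {n : ℕ} (A : Matrix (Fin n) (Fin n) ℝ)
    (u : EuclideanSpace ℝ (Fin n)) : ∃ b : EuclideanSpace ℝ (Fin n),
      ∀ v, quad A (u + v) = quad A u + quad A v + ⟪b, v⟫ := by
  refine ⟨WithLp.toLp 2 fun j => ∑ i, (A i j + A j i) * u i, fun v => ?_⟩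
  have hb : ⟪(WithLp.toLp 2 fun j => ∑ i, (A i j + A j i) * u i : EuclideanSpace ℝ (Fin n)), v⟫
      = ∑ i, ∑ j, A i j * u i * v j + ∑ i, ∑ j, A i j * v i * u j := by
    simp only [PiLp.inner_apply, RCLike.inner_apply, conj_trivial, Finset.mul_sum]
    rw [Finset.sum_comm (f := fun i j => A i j * u i * v j)]
    simp only [← Finset.sum_add_distrib]
    refine Finset.sum_congr rfl fun i _ => Finset.sum_congr rfl fun j _ => ?_
    ring
  rw [hb]
  simp only [quad, ← Finset.sum_add_distrib, PiLp.add_apply]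
  refine Finset.sum_congr rfl fun i _ => Finset.sum_congr rfl fun j _ => ?_
  ring

theorem quad_le_sum_abs_mul_norm_sq {n : ℕ} (A : Matrix (Fin n) (Fin n) ℝ)
    (v : EuclideanSpace ℝ (Fin n)) : quad A v ≤ (∑ i, ∑ j, |A i j|) * ‖v‖ ^ 2 := by
  simp only [quad, Finset.sum_mul]
  refine Finset.sum_le_sum fun i _ => Finset.sum_le_sum fun j _ => ?_
  have hi : |v i| ≤ ‖v‖ := PiLp.norm_apply_le v i
  have hj : |v j| ≤ ‖v‖ := PiLp.norm_apply_le v j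
  calc A i j * v i * v j ≤ |A i j * v i * v j| := le_abs_self _
    _ = |A i j| * (|v i| * |v j|) := by rw [abs_mul, abs_mul, mul_assoc]
    _ ≤ |A i j| * (‖v‖ * ‖v‖) := by gcongr
    _ = |A i j| * ‖v‖ ^ 2 := by rw [sq]

theorem continuous_quad {n : ℕ} (A : Matrix (Fin n) (Fin n) ℝ) : Continuous (quad A) := by
  unfold quad
  fun_prop

theorem QCOn.continuousOn {n : ℕ} {lam : ℝ} {U : Set (EuclideanSpace ℝ (Fin n))}
    {w : EuclideanSpace ℝ (Fin n) → ℝ} (hw : QCOn lam U w) (hU : IsOpen U) :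
    ContinuousOn w U := by
  have h : ContinuousOn (fun x => w x + (lam / 2) * ‖x‖ ^ 2) U :=
    ConvexOn.continuousOn hU hw
  exact (h.sub (g := fun x => (lam / 2) * ‖x‖ ^ 2) (by fun_prop)).congr fun x _ => by simp

theorem QCOn.two_mul_le {n : ℕ} {lam : ℝ} {U : Set (EuclideanSpace ℝ (Fin n))}
    {w : EuclideanSpace ℝ (Fin n) → ℝ} (hw : QCOn lam U w) {x h : EuclideanSpace ℝ (Fin n)}
    (h₁ : x + h ∈ U) (h₂ : x - h ∈ U) :
    2 * w x ≤ w (x + h) + w (x - h) + lam * ‖h‖ ^ 2 := by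
  have e := hw.2 h₁ h₂ (show (0 : ℝ) ≤ 1 / 2 by norm_num) (show (0 : ℝ) ≤ 1 / 2 by norm_num)
    (by norm_num)
  have hx : (1 / 2 : ℝ) • (x + h) + (1 / 2 : ℝ) • (x - h) = x := by module
  simp only [hx, smul_eq_mul] at e
  have p := parallelogram_law_with_norm ℝ x h
  have p' : lam * (‖x + h‖ ^ 2 + ‖x - h‖ ^ 2) = lam * (2 * (‖x‖ ^ 2 + ‖h‖ ^ 2)) := by rw [p]
  linarith

/-- (Jensen–Slodkowski) If `w` is `lam`-quasi-convex on a ball around `x₀` and has a strict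
upper contact jet `(p₀, A₀)` at `x₀`, then there is `ρ̄ > 0` such that for all `0 < ρ ≤ ρ̄`
the set of global upper contact points of type `A₀` for `w` on `B_ρ(x₀)` has positive
Lebesgue measure. -/
theorem stmt_11 {n : ℕ} (x₀ : EuclideanSpace ℝ (Fin n)) (r : ℝ) (hr : 0 < r)
    (w : EuclideanSpace ℝ (Fin n) → ℝ) (lam : ℝ) (hlam : 0 ≤ lam)
    (hqc : QCOn lam (Metric.ball x₀ r) w)
    (p₀ : EuclideanSpace ℝ (Fin n)) (A₀ : Matrix (Fin n) (Fin n) ℝ) (hA₀ : A₀.IsSymm)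
    (hstrict : ∀ᶠ y in 𝓝[≠] x₀,
      w y < w x₀ + ⟪p₀, y - x₀⟫ + (1 / 2) * quad A₀ (y - x₀)) :
    ∃ ρbar : ℝ, 0 < ρbar ∧ ∀ ρ : ℝ, 0 < ρ → ρ ≤ ρbar →
      0 < volume {x | x ∈ Metric.ball x₀ ρ ∧ ∃ q : EuclideanSpace ℝ (Fin n),
        ∀ y ∈ Metric.ball x₀ ρ,
          w y ≤ w x + ⟪q, y - x⟫ + (1 / 2) * quad A₀ (y - x)} := by
  obtain ⟨ε, hε, hεs⟩ := Metric.eventually_nhds_iff_ball.1 (eventually_nhdsWithin_iff.1 hstrict)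
  refine ⟨min ε r / 2, by positivity, fun ρ hρ hρle => ?_⟩
  have hρε : ρ < ε := by linarith [min_le_left ε r, lt_min hε hr]
  have hρr : ρ < r := by linarith [min_le_right ε r, lt_min hε hr]
  have hsub : Metric.closedBall x₀ ρ ⊆ Metric.ball x₀ r := Metric.closedBall_subset_ball hρr
  set f : EuclideanSpace ℝ (Fin n) → ℝ :=
    fun y => w y - (w x₀ + ⟪p₀, y - x₀⟫ + (1 / 2) * quad A₀ (y - x₀)) with hf
  have hq0 : quad A₀ 0 = 0 := by simpa using quad_smul A₀ 0 0
  have hcont : ContinuousOn f (Metric.closedBall x₀ ρ) := by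
    refine ((hqc.continuousOn Metric.isOpen_ball).mono hsub).sub (Continuous.continuousOn ?_)
    have := (continuous_quad A₀).comp
      (continuous_id.sub continuous_const : Continuous fun y => y - x₀)
    exact (by fun_prop : Continuous fun y => w x₀ + ⟪p₀, y - x₀⟫).add (continuous_const.mul this)
  have hneg : ∀ y ∈ Metric.closedBall x₀ ρ, y ≠ x₀ → f y < 0 := fun y hy hne =>
    sub_neg.2 (hεs y (Metric.closedBall_subset_ball hρε hy) hne)
  have hM : 0 ≤ ∑ i, ∑ j, |A₀ i j| :=
    Finset.sum_nonneg fun i _ => Finset.sum_nonneg fun j _ => abs_nonneg _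
  have hsemi : ∀ x h, x + h ∈ Metric.ball x₀ ρ → x - h ∈ Metric.ball x₀ ρ →
      2 * f x ≤ f (x + h) + f (x - h) + (lam + ∑ i, ∑ j, |A₀ i j|) * ‖h‖ ^ 2 := by
    intro x h h₁ h₂
    have e := hqc.two_mul_le (hsub (Metric.ball_subset_closedBall h₁))
      (hsub (Metric.ball_subset_closedBall h₂))
    obtain ⟨b, hb⟩ := exists_quad_add A₀ (x - x₀)
    have b₁ := hb h
    have b₂ := hb (-h)
    have b₃ : quad A₀ (-h) = quad A₀ h := by simpa using quad_smul A₀ (-1) h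
    rw [inner_neg_right, b₃] at b₂
    have q := quad_le_sum_abs_mul_norm_sq A₀ h
    have s₁ : x + h - x₀ = x - x₀ + h := by abel
    have s₂ : x - h - x₀ = x - x₀ + -h := by abel
    simp only [hf, s₁, s₂, b₁, b₂, inner_add_right, inner_neg_right]
    linarith
  have hpos := measure_affine_contact_pos volume hρ hcont (by simp [hf, hq0]) hneg hsemi
    (add_nonneg hlam hM)
  refine hpos.trans_le (measure_mono ?_)
  rintro x ⟨hx, q, hq⟩
  obtain ⟨b, hb⟩ := exists_quad_add A₀ (x - x₀)
  refine ⟨hx, q + p₀ + (1 / 2 : ℝ) • b, fun y hy => ?_⟩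
  have e := hq y hy
  have b₁ := hb (y - x)
  have s : x - x₀ + (y - x) = y - x₀ := by abel
  have s' : ⟪p₀, y - x₀⟫ = ⟪p₀, x - x₀⟫ + ⟪p₀, y - x⟫ := by rw [← inner_add_right, s]
  rw [s] at b₁
  simp only [hf, b₁, s'] at e
  rw [inner_add_left, inner_add_left, real_inner_smul_left]
  linarith
end
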